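/- arXiv:2006.11959 — 4 statements merged into one kernel-verified Lean document; each statement's English description precedes it below -/
import Mathlib

section
/- Let g, t, λ be natural numbers, let χ be an integer, and let a₁, …, a_λ be integers with 0 ≤ aᵢ ≤ 1 for all i. Assume 3χ ≥ 1 − g, and that χ ≥ 1 whenever g = 0. Assume moreover that (as rational numbers) 2g − 2 + χ + t + Σᵢ aᵢ/2 > 0. Then for every integer m ≥ 6 one has m·(2g − 2 + χ + t) + Σᵢ ⌊m·aᵢ/2⌋ ≥ 2g + 1. -/
/-- Numerical core of Theorem 5.1: characteristic 2, multiple fibers of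
multiplicity 2, coefficients `a i ∈ {0,1}`. -/
theorem stmt_0 (g t lam : ℕ) (χ : ℤ) (a : Fin lam → ℤ)
    (ha : ∀ i, 0 ≤ a i ∧ a i ≤ 1)
    (hchi : 3 * χ ≥ 1 - (g : ℤ))
    (hchi0 : g = 0 → χ ≥ 1)
    (hkod : (2 * g - 2 + χ + t + ∑ i, (a i : ℚ) / 2 : ℚ) > 0) :
    ∀ m : ℤ, m ≥ 6 →
      m * (2 * g - 2 + χ + t) + ∑ i, ⌊(m * a i : ℚ) / 2⌋ ≥ 2 * g + 1 := by
  intro m hm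
  have hfl : ∀ i, ⌊(m * a i : ℚ) / 2⌋ = a i * (m / 2) := by
    intro i
    have h1 : ⌊((m * a i : ℤ) : ℚ) / ((2 : ℕ) : ℚ)⌋ = (m * a i) / ((2 : ℕ) : ℤ) :=
      Rat.floor_intCast_div_natCast _ _
    push_cast at h1
    rw [h1]
    obtain ⟨h0, h2⟩ := ha i
    have h3 : a i = 0 ∨ a i = 1 := by omega
    rcases h3 with h | h <;> simp [h]
  simp only [hfl]
  rw [← Finset.sum_mul]
  rw [← Finset.sum_div] at hkod
  have hs : 0 ≤ ∑ i, a i := Finset.sum_nonneg fun i _ => (ha i).1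
  have hk : 0 < 2 * (2 * (g : ℤ) - 2 + χ + t) + ∑ i, a i := by
    have : (0 : ℚ) < ((2 * (2 * (g : ℤ) - 2 + χ + t) + ∑ i, a i : ℤ) : ℚ) := by
      push_cast
      linarith
    exact_mod_cast this
  generalize ∑ i, a i = s at *
  obtain ⟨N, hN⟩ : ∃ N : ℤ, N = 2 * (g : ℤ) - 2 + χ + t := ⟨_, rfl⟩
  rw [← hN] at hk ⊢
  obtain ⟨k, hkk⟩ : ∃ k : ℤ, k = m / 2 := ⟨_, rfl⟩
  rw [← hkk]
  have hk3 : 3 ≤ k := by omega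
  have hmk : m ≤ 2 * k + 1 := by omega
  have hsk : 0 ≤ s * k := by positivity
  by_cases hN1 : 1 ≤ N
  · have h6 : 6 * N ≤ m * N := by nlinarith
    have : 2 * (g : ℤ) + 1 ≤ 6 * N := by omega
    linarith
  · have hcase : (N = 0 ∧ g ≤ 1) ∨ (N = -1 ∧ g = 0) := by
      by_cases hg : g = 0
      · have := hchi0 hg
        omega
      · omega
    rcases hcase with ⟨h, hg⟩ | ⟨h, hg⟩
    · subst h
      have hg' : (g : ℤ) ≤ 1 := by exact_mod_cast hg
      nlinarith
    · rw [h] at hk ⊢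
      subst hg
      have : 3 * k ≤ s * k := by nlinarith
      push_cast
      linarith
end

section
/- Let K be a field of characteristic 2, let D : K → K be a derivation, and suppose there exists γ ∈ K with D(D(a)) = γ·D(a) for all a ∈ K. Then for all x, y ∈ K with D(y) ≠ 0, D(D(x)/D(y)) = 0. -/
/-- Corollary 3.2: for a 2-closed derivation `D` (i.e. `D² = γ·D`) on a field
of characteristic 2, the quotient `D x / D y` is a `D`-constant. -/
theorem stmt_3 {K : Type*} [Field K] [CharP K 2]
    (D : Derivation ℤ K K) (γ : K) (hγ : ∀ a : K, D (D a) = γ * D a) :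
    ∀ x y : K, D y ≠ 0 → D (D x / D y) = 0 := by
  intro x y _
  rw [Derivation.leibniz_div, hγ, hγ]
  simp only [smul_eq_mul]
  ring
end

section
/- Let K be a field of characteristic 2, let D : K → K be a derivation, and suppose there exists γ ∈ K with D(D(a)) = γ·D(a) for all a ∈ K. Let x, y ∈ K and set f = D(x), g = D(y), and assume g ≠ 0. Then D(x + (f/g)·y) = 0, and also D(y²) = 0. -/
/-- Key computation in Proposition 3.4: with `f = D x`, `g = D y` and `g ≠ 0`,
the element `x + (f/g)·y` is a `D`-constant, and so is `y²`. -/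
theorem stmt_4 {K : Type*} [Field K] [CharP K 2]
    (D : Derivation ℤ K K) (γ : K) (hγ : ∀ a : K, D (D a) = γ * D a)
    (x y : K) (f g : K) (hf : f = D x) (hg : g = D y) (hg0 : g ≠ 0) :
    D (x + (f / g) * y) = 0 ∧ D (y ^ 2) = 0 := by
  have h2 : (2 : K) = 0 := CharTwo.two_eq_zero
  have hDf : D f = γ * f := by rw [hf, hγ]
  have hDg : D g = γ * g := by rw [hg, hγ]
  obtain ⟨q, hq⟩ : ∃ q, q = f / g := ⟨_, rfl⟩
  have hqg : q * g = f := by rw [hq]; exact div_mul_cancel₀ f hg0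
  have hDq : D q = 0 := by
    have h := congrArg D hqg
    rw [Derivation.leibniz, hDf, hDg, smul_eq_mul, smul_eq_mul] at h
    have h' : g * D q = 0 := by linear_combination h - γ * hqg
    exact (mul_eq_zero.mp h').resolve_left hg0
  constructor
  · rw [← hq, map_add, Derivation.leibniz, hDq, ← hf, ← hg, smul_eq_mul, smul_zero]
    linear_combination hqg + f * h2
  · rw [pow_two, Derivation.leibniz, smul_eq_mul]
    linear_combination (y * D y) * h2
end

section
/- Let k be a field of characteristic 2 and let A = k[x, y, t]/(y² + y + x³). There is a (unique) k-derivation D : A → A with D(x̄) = ȳ, D(ȳ) = x̄²·ȳ, and D(t̄) = x̄² + x̄²·t̄ + t̄⁴; moreover this derivation satisfies D(D(a)) = x̄²·D(a) for all a ∈ A, i.e., D² = x̄²·D, so D is 2-closed. -/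
open MvPolynomial

set_option synthInstance.maxHeartbeats 1000000

/-- The affine coordinate ring `k[x,y,t]/(y² + y + x³)` of `E × 𝔸¹` in
characteristic 2, where `E : y² + y = x³`. -/
noncomputable abbrev QEring (k : Type*) [Field k] : Type _ :=
  MvPolynomial (Fin 3) k ⧸
    Ideal.span {(X 1 : MvPolynomial (Fin 3) k) ^ 2 + X 1 + (X 0) ^ 3}

theorem aux_ind {k A : Type*} [Field k] [CommRing A] [Algebra k A]
    (f : MvPolynomial (Fin 3) k →ₐ[k] A) (hf : Function.Surjective f) (p : A → Prop)
    (hC : ∀ c : k, p (algebraMap k A c)) (ha : ∀ a b, p a → p b → p (a + b))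
    (hm : ∀ a b, p a → p b → p (a * b))
    (h0 : p (f (X 0))) (h1 : p (f (X 1))) (h2 : p (f (X 2))) (a : A) : p a := by
  obtain ⟨q, rfl⟩ := hf a
  induction q using MvPolynomial.induction_on with
  | C c =>
    have : f (C c) = algebraMap k A c := f.commutes c
    rw [this]; exact hC c
  | add q r hq hr => rw [map_add]; exact ha _ _ hq hr
  | mul_X q i hq =>
    rw [map_mul]
    refine hm _ _ hq ?_
    fin_cases i
    · exact h0
    · exact h1
    · exact h2

theorem aux_uniq {k A : Type*} [Field k] [CommRing A] [Algebra k A]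
    (f : MvPolynomial (Fin 3) k →ₐ[k] A) (hf : Function.Surjective f)
    (D E : Derivation k A A) (h0 : D (f (X 0)) = E (f (X 0)))
    (h1 : D (f (X 1)) = E (f (X 1))) (h2 : D (f (X 2)) = E (f (X 2))) : D = E := by
  ext a
  refine aux_ind f hf (fun a => D a = E a) ?_ ?_ ?_ h0 h1 h2 a
  · intro c; simp
  · intro a b ha hb; simp only [map_add, ha, hb]
  · intro a b ha hb; simp only [Derivation.leibniz, ha, hb]

theorem aux_sq {k A : Type*} [Field k] [CommRing A] [Algebra k A]
    (f : MvPolynomial (Fin 3) k →ₐ[k] A) (hf : Function.Surjective f) (h2 : (2 : A) = 0)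
    (D : Derivation k A A) (hx : D (f (X 0)) = f (X 1))
    (hy : D (f (X 1)) = f (X 0) ^ 2 * f (X 1))
    (ht : D (f (X 2)) = f (X 0) ^ 2 + f (X 0) ^ 2 * f (X 2) + f (X 2) ^ 4) (a : A) :
    D (D a) = f (X 0) ^ 2 * D a := by
  refine aux_ind f hf (fun a => D (D a) = f (X 0) ^ 2 * D a) ?_ ?_ ?_ ?_ ?_ ?_ a
  · intro c; simp
  · intro a b ha hb; simp only [map_add, ha, hb]; ring
  · intro a b ha hb
    simp only [Derivation.leibniz, map_add, smul_eq_mul, ha, hb]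
    linear_combination (D a * D b) * h2
  · simp only [hx, hy]
  · simp only [hy, hx, Derivation.leibniz, Derivation.leibniz_pow, smul_eq_mul, nsmul_eq_mul]
    push_cast
    linear_combination (f (X 0) * f (X 1) ^ 2) * h2
  · simp only [hy, hx, ht, map_add, Derivation.leibniz, Derivation.leibniz_pow, smul_eq_mul,
      nsmul_eq_mul]
    push_cast
    linear_combination (f (X 0) * f (X 1) + f (X 0) * f (X 1) * f (X 2) + 2 * f (X 2) ^ 3 *
      (f (X 0) ^ 2 + f (X 0) ^ 2 * f (X 2) + f (X 2) ^ 4)) * h2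

theorem aux_ex {k A : Type*} [Field k] [CharP k 2] [CommRing A] [Algebra k A]
    (f : MvPolynomial (Fin 3) k →ₐ[k] A) (hf : Function.Surjective f)
    (hker : ∀ q, f q = 0 → ∃ r, q = (X 1 ^ 2 + X 1 + X 0 ^ 3) * r)
    (hg : f (X 1 ^ 2 + X 1 + X 0 ^ 3) = 0) :
    ∃ D : Derivation k A A, D (f (X 0)) = f (X 1) ∧
      D (f (X 1)) = f (X 0 ^ 2 * X 1) ∧
      D (f (X 2)) = f (X 0 ^ 2 + X 0 ^ 2 * X 2 + X 2 ^ 4) := by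
  have h2 : (2 : MvPolynomial (Fin 3) k) = 0 := CharTwo.two_eq_zero
  let d : Derivation k (MvPolynomial (Fin 3) k) (MvPolynomial (Fin 3) k) :=
    mkDerivation k ![X 1, X 0 ^ 2 * X 1, X 0 ^ 2 + X 0 ^ 2 * X 2 + X 2 ^ 4]
  have d0 : d (X 0) = X 1 := by simp [d, mkDerivation_X]
  have d1 : d (X 1) = X 0 ^ 2 * X 1 := by simp [d, mkDerivation_X]
  have d2 : d (X 2) = X 0 ^ 2 + X 0 ^ 2 * X 2 + X 2 ^ 4 := by simp [d, mkDerivation_X]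
  have dg : d (X 1 ^ 2 + X 1 + X 0 ^ 3) = 0 := by
    simp only [map_add, Derivation.leibniz_pow, d0, d1, smul_eq_mul, nsmul_eq_mul]
    push_cast
    linear_combination (X 0 ^ 2 * X 1 ^ 2 + 2 * X 0 ^ 2 * X 1) * h2
  have hd : ∀ q, f q = 0 → f (d q) = 0 := by
    intro q hq
    obtain ⟨r, rfl⟩ := hker q hq
    rw [Derivation.leibniz, dg, smul_zero, add_zero, smul_eq_mul, map_mul, hg, zero_mul]
  refine ⟨Derivation.liftOfSurjective hf hd, ?_, ?_, ?_⟩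
  · rw [Derivation.liftOfSurjective_apply, d0]
  · rw [Derivation.liftOfSurjective_apply, d1]
  · rw [Derivation.liftOfSurjective_apply, d2]

/-- Section 4: on `A = k[x,y,t]/(y²+y+x³)` with char k = 2, there is a unique
`k`-derivation `D` with `D x = y`, `D y = x²y`, `D t = x² + x²t + t⁴`
(the vector field `y ∂/∂x + (x² + x²t + t⁴) ∂/∂t`), and any such derivation
satisfies `D² = x²·D`, i.e. `D` is 2-closed. -/
theorem stmt_5 (k : Type*) [Field k] [CharP k 2] :
    (∃! D : Derivation k (QEring k) (QEring k),
      D (Ideal.Quotient.mk _ (X 0)) = Ideal.Quotient.mk _ (X 1) ∧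
      D (Ideal.Quotient.mk _ (X 1)) =
        Ideal.Quotient.mk _ ((X 0) ^ 2 * X 1) ∧
      D (Ideal.Quotient.mk _ (X 2)) =
        Ideal.Quotient.mk _ ((X 0) ^ 2 + (X 0) ^ 2 * X 2 + (X 2) ^ 4)) ∧
    (∀ D : Derivation k (QEring k) (QEring k),
      (D (Ideal.Quotient.mk _ (X 0)) = Ideal.Quotient.mk _ (X 1) ∧
       D (Ideal.Quotient.mk _ (X 1)) =
         Ideal.Quotient.mk _ ((X 0) ^ 2 * X 1) ∧
       D (Ideal.Quotient.mk _ (X 2)) =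
         Ideal.Quotient.mk _ ((X 0) ^ 2 + (X 0) ^ 2 * X 2 + (X 2) ^ 4)) →
      ∀ a : QEring k, D (D a) = Ideal.Quotient.mk _ ((X 0) ^ 2) * D a) := by
  let I : Ideal (MvPolynomial (Fin 3) k) :=
    Ideal.span {(X 1 : MvPolynomial (Fin 3) k) ^ 2 + X 1 + (X 0) ^ 3}
  let f : MvPolynomial (Fin 3) k →ₐ[k] QEring k := Ideal.Quotient.mkₐ k I
  have hf : Function.Surjective f := Ideal.Quotient.mkₐ_surjective k I
  have h2 : (2 : QEring k) = 0 := by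
    have h : (2 : MvPolynomial (Fin 3) k) = 0 := CharTwo.two_eq_zero
    have := congrArg f h
    rwa [map_ofNat, map_zero] at this
  constructor
  · obtain ⟨D, h0, h1, h3⟩ := aux_ex f hf
      (fun q hq => Ideal.mem_span_singleton.1 (Ideal.Quotient.eq_zero_iff_mem.1 hq))
      (Ideal.Quotient.eq_zero_iff_mem.2 (Ideal.mem_span_singleton_self _))
    refine ⟨D, ⟨h0, h1, h3⟩, ?_⟩
    rintro E ⟨e0, e1, e3⟩
    exact aux_uniq f hf E D (e0.trans h0.symm) (e1.trans h1.symm) (e3.trans h3.symm)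
  · rintro D ⟨h0, h1, h3⟩ a
    have := aux_sq f hf h2 D h0 (h1.trans (by rw [map_mul, map_pow]; rfl))
      (h3.trans (by simp only [map_mul, map_pow, map_add]; rfl)) a
    rw [this, map_pow]; rfl
end
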